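/- In every associative dialgebra D over a commutative ring, the PATS satisfies the nonlinear degree-7 identity 12·I_{31111} = 0 in variables a (occurring three times) and b,c,d,e: for all a,b,c,d,e ∈ D, 3Σ₁ − Σ₂ − Σ₃ − 2Σ₄ = 0, where σ ranges over all permutations of the five letters (a,b,c,d,e) and Σ₁ = Σ_{σ∈S₅} ε(σ)[[[a,aσ,bσ],a,cσ],dσ,eσ], Σ₂ = Σ_{σ∈S₅} ε(σ)[[a,[aσ,bσ,cσ],a],dσ,eσ], Σ₃ = Σ_{σ∈S₅} ε(σ)[[a,aσ,bσ],[cσ,dσ,eσ],a], Σ₄ = Σ_{σ∈S₅} ε(σ)[a,[[bσ,cσ,dσ],a,eσ],aσ]. -/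

import Mathlib

/-- An associative dialgebra over a commutative ring `k`: a `k`-module `D` with two
bilinear products `l` (left, `⊣`) and `r` (right, `⊢`) satisfying the five dialgebra axioms. -/
structure Dialgebra (k : Type*) (D : Type*) [CommRing k] [AddCommGroup D] [Module k D] where
  l : D →ₗ[k] D →ₗ[k] D
  r : D →ₗ[k] D →ₗ[k] D
  l_assoc : ∀ a b c : D, l (l a b) c = l a (l b c)
  r_assoc : ∀ a b c : D, r (r a b) c = r a (r b c)
  inner_assoc : ∀ a b c : D, l (r a b) c = r a (l b c)
  bar_right : ∀ a b c : D, r (l a b) c = r (r a b) c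
  bar_left : ∀ a b c : D, l a (l b c) = l a (r b c)

/-- The partially alternating ternary sum (PATS):
`[a,b,c] = a⊣b⊣c − a⊣c⊣b − (b⊢a)⊣c + (c⊢a)⊣b + b⊢(c⊢a) − c⊢(b⊢a)`. -/
def Dialgebra.pats {k D : Type*} [CommRing k] [AddCommGroup D] [Module k D]
    (A : Dialgebra k D) (a b c : D) : D :=
  A.l (A.l a b) c - A.l (A.l a c) b - A.l (A.r b a) c + A.l (A.r c a) b
    + A.r b (A.r c a) - A.r c (A.r b a)

/-- A monomial of the free dialgebra on `ι`: a word with a distinguished central letter. -/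
structure MarkedWord (ι : Type*) where
  left : List ι
  center : ι
  right : List ι
deriving DecidableEq

namespace MarkedWord

variable {ι : Type*}

/-- The underlying word. -/
def word (m : MarkedWord ι) : List ι := m.left ++ m.center :: m.right

/-- Rename the letters. -/
def map (f : ι → ι) (m : MarkedWord ι) : MarkedWord ι :=
  ⟨m.left.map f, f m.center, m.right.map f⟩

/-- The product `⊣`, which keeps the left center. -/
def mulLeft (m n : MarkedWord ι) : MarkedWord ι := ⟨m.left, m.center, m.right ++ n.word⟩

/-- The product `⊢`, which keeps the right center. -/
def mulRight (m n : MarkedWord ι) : MarkedWord ι := ⟨m.word ++ n.left, n.center, n.right⟩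

end MarkedWord

/-- Formal integer combinations of marked words, without collecting equal words. -/
abbrev MarkedPoly (ι : Type*) := List (ℤ × MarkedWord ι)

namespace MarkedPoly

variable {ι : Type*}

/-- Bilinear extension of a product of marked words. -/
def lift (f : MarkedWord ι → MarkedWord ι → MarkedWord ι) (p q : MarkedPoly ι) : MarkedPoly ι :=
  p.flatMap fun s => q.map fun t => (s.1 * t.1, f s.2 t.2)

/-- Scalar multiplication. -/
def scale (c : ℤ) (p : MarkedPoly ι) : MarkedPoly ι := p.map fun t => (c * t.1, t.2)

/-- The terms of the partially alternating ternary sum of formal polynomials with the last two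
arguments in one of their two orders. -/
def halfPats (p q s : MarkedPoly ι) : MarkedPoly ι :=
  lift .mulLeft (lift .mulLeft p q) s ++ scale (-1) (lift .mulLeft (lift .mulRight q p) s)
    ++ lift .mulRight q (lift .mulRight s p)

/-- The partially alternating ternary sum of formal polynomials. -/
def pats (p q s : MarkedPoly ι) : MarkedPoly ι :=
  halfPats p q s ++ scale (-1) (halfPats p s q)

/-- The monomial consisting of a single letter. -/
def var (i : ι) : MarkedPoly ι := [(1, ⟨[], i, []⟩)]

/-- Evaluation against a function on marked words. -/
def sum {D : Type*} [AddCommGroup D] (φ : MarkedWord ι → D) (p : MarkedPoly ι) : D :=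
  (p.map fun t => t.1 • φ t.2).sum

section sum

variable {D : Type*} [AddCommGroup D] (φ : MarkedWord ι → D)

@[simp] lemma sum_nil : sum φ [] = 0 := rfl

@[simp] lemma sum_cons (t : ℤ × MarkedWord ι) (p : MarkedPoly ι) :
    sum φ (t :: p) = t.1 • φ t.2 + sum φ p := by
  simp [sum]

@[simp] lemma sum_append (p q : MarkedPoly ι) : sum φ (p ++ q) = sum φ p + sum φ q := by
  simp [sum]

@[simp] lemma sum_scale (c : ℤ) (p : MarkedPoly ι) : sum φ (scale c p) = c • sum φ p := by
  induction p with
  | nil => simp [scale]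
  | cons t p ih =>
    rw [sum_cons, smul_add, ← ih]
    simp [scale, mul_smul]

lemma sum_lift {k : Type*} [CommRing k] [Module k D] (B : D →ₗ[k] D →ₗ[k] D)
    (f : MarkedWord ι → MarkedWord ι → MarkedWord ι)
    (h : ∀ m n, φ (f m n) = B (φ m) (φ n)) (p q : MarkedPoly ι) :
    sum φ (lift f p q) = B (sum φ p) (sum φ q) := by
  induction p with
  | nil => simp [lift]
  | cons s p ih =>
    have key : sum φ (q.map fun t => (s.1 * t.1, f s.2 t.2)) = s.1 • B (φ s.2) (sum φ q) := by
      clear ih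
      induction q with
      | nil => simp
      | cons t q ihq => simp [ihq, h, mul_smul]
    have hl : lift f (s :: p) q = (q.map fun t => (s.1 * t.1, f s.2 t.2)) ++ lift f p q := rfl
    rw [hl, sum_append, key, ih]
    simp

lemma sum_finset_sum {α : Type*} (s : Finset α) (c : α → ℤ) (ψ : α → MarkedWord ι → D)
    (p : MarkedPoly ι) :
    ∑ x ∈ s, c x • sum (ψ x) p = sum (fun m => ∑ x ∈ s, c x • ψ x m) p := by
  induction p with
  | nil => simp
  | cons t p ih =>
    simp only [sum_cons, smul_add, Finset.sum_add_distrib, ih, Finset.smul_sum]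
    simp only [smul_comm t.1]

end sum

end MarkedPoly

namespace Dialgebra

variable {ι k D : Type*} [CommRing k] [AddCommGroup D] [Module k D] (A : Dialgebra k D)

/-- Left multiplication by the letters of a word. -/
def leftAct (y : ι → D) (u : List ι) (z : D) : D := u.foldr (fun i z => A.r (y i) z) z

/-- Right multiplication by the letters of a word. -/
def rightAct (y : ι → D) (z : D) (w : List ι) : D := w.foldl (fun z i => A.l z (y i)) z

/-- The value of a marked word. -/
def evalWord (y : ι → D) (m : MarkedWord ι) : D :=
  A.leftAct y m.left (A.rightAct y (y m.center) m.right)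

lemma leftAct_append (y : ι → D) (u w : List ι) (z : D) :
    A.leftAct y (u ++ w) z = A.leftAct y u (A.leftAct y w z) := by
  simp [leftAct]

lemma rightAct_append (y : ι → D) (u w : List ι) (z : D) :
    A.rightAct y z (u ++ w) = A.rightAct y (A.rightAct y z u) w := by
  simp [rightAct]

lemma l_leftAct (y : ι → D) (u : List ι) (z t : D) :
    A.l (A.leftAct y u z) t = A.leftAct y u (A.l z t) := by
  induction u with
  | nil => rfl
  | cons i u ih => simpa [leftAct, A.inner_assoc] using congrArg (A.r (y i)) ih

lemma l_leftAct_right (y : ι → D) (u : List ι) (z t : D) :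
    A.l z (A.leftAct y u t) = A.l (A.rightAct y z u) t := by
  induction u generalizing z with
  | nil => rfl
  | cons i u ih =>
    change A.l z (A.r (y i) (A.leftAct y u t)) = A.l (A.rightAct y (A.l z (y i)) u) t
    rw [← ih, ← A.bar_left, A.l_assoc]

lemma l_rightAct (y : ι → D) (w : List ι) (z t : D) :
    A.l z (A.rightAct y t w) = A.rightAct y (A.l z t) w := by
  induction w generalizing t with
  | nil => rfl
  | cons i w ih =>
    change A.l z (A.rightAct y (A.l t (y i)) w) = A.rightAct y (A.l (A.l z t) (y i)) w
    rw [ih, A.l_assoc]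

lemma r_leftAct (y : ι → D) (u : List ι) (z t : D) :
    A.r (A.leftAct y u z) t = A.leftAct y u (A.r z t) := by
  induction u with
  | nil => rfl
  | cons i u ih => simpa [leftAct, A.r_assoc] using congrArg (A.r (y i)) ih

lemma r_rightAct (y : ι → D) (w : List ι) (z t : D) :
    A.r (A.rightAct y z w) t = A.r z (A.leftAct y w t) := by
  induction w generalizing z with
  | nil => rfl
  | cons i w ih =>
    change A.r (A.rightAct y (A.l z (y i)) w) t = A.r z (A.r (y i) (A.leftAct y w t))
    rw [ih, A.bar_right, A.r_assoc]

lemma evalWord_mulLeft (y : ι → D) (m n : MarkedWord ι) :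
    A.evalWord y (m.mulLeft n) = A.l (A.evalWord y m) (A.evalWord y n) := by
  simp only [evalWord, MarkedWord.mulLeft, MarkedWord.word, rightAct_append]
  rw [l_leftAct, l_leftAct_right, l_rightAct]
  rfl

lemma evalWord_mulRight (y : ι → D) (m n : MarkedWord ι) :
    A.evalWord y (m.mulRight n) = A.r (A.evalWord y m) (A.evalWord y n) := by
  simp only [evalWord, MarkedWord.mulRight, MarkedWord.word, r_leftAct, r_rightAct,
    leftAct_append]
  rfl

lemma evalWord_map (y : ι → D) (f : ι → ι) (m : MarkedWord ι) :
    A.evalWord y (m.map f) = A.evalWord (y ∘ f) m := by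
  simp [evalWord, MarkedWord.map, leftAct, rightAct, List.foldr_map, List.foldl_map]

lemma sum_evalWord_var (y : ι → D) (i : ι) :
    MarkedPoly.sum (A.evalWord y) (MarkedPoly.var i) = y i := by
  simp [MarkedPoly.var, evalWord, leftAct, rightAct]

/-- The terms of the partially alternating ternary sum with the last two arguments in one of
their two orders. -/
def halfPats (x y z : D) : D := A.l (A.l x y) z - A.l (A.r y x) z + A.r y (A.r z x)

lemma pats_eq_halfPats_sub (x y z : D) :
    A.pats x y z = A.halfPats x y z - A.halfPats x z y := by
  simp only [pats, halfPats]
  abel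

lemma halfPats_sub_left (x x' y z : D) :
    A.halfPats (x - x') y z = A.halfPats x y z - A.halfPats x' y z := by
  simp only [halfPats, map_sub, LinearMap.sub_apply]
  abel

lemma halfPats_sub_middle (x y y' z : D) :
    A.halfPats x (y - y') z = A.halfPats x y z - A.halfPats x y' z := by
  simp only [halfPats, map_sub, LinearMap.sub_apply]
  abel

lemma halfPats_sub_right (x y z z' : D) :
    A.halfPats x y (z - z') = A.halfPats x y z - A.halfPats x y z' := by
  simp only [halfPats, map_sub, LinearMap.sub_apply]
  abel

lemma pats_sub_left (x x' y z : D) :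
    A.pats (x - x') y z = A.pats x y z - A.pats x' y z := by
  simp only [pats_eq_halfPats_sub, halfPats_sub_left]
  abel

lemma pats_sub_middle (x y y' z : D) :
    A.pats x (y - y') z = A.pats x y z - A.pats x y' z := by
  simp only [pats_eq_halfPats_sub, halfPats_sub_middle, halfPats_sub_right]
  abel

lemma sum_evalWord_halfPats (y : ι → D) (p q s : MarkedPoly ι) :
    MarkedPoly.sum (A.evalWord y) (MarkedPoly.halfPats p q s) =
      A.halfPats (MarkedPoly.sum (A.evalWord y) p) (MarkedPoly.sum (A.evalWord y) q)
        (MarkedPoly.sum (A.evalWord y) s) := by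
  simp only [MarkedPoly.halfPats, MarkedPoly.sum_append, MarkedPoly.sum_scale,
    MarkedPoly.sum_lift _ A.l _ (A.evalWord_mulLeft y),
    MarkedPoly.sum_lift _ A.r _ (A.evalWord_mulRight y), halfPats, neg_smul, one_smul]
  abel

lemma sum_evalWord_pats (y : ι → D) (p q s : MarkedPoly ι) :
    MarkedPoly.sum (A.evalWord y) (MarkedPoly.pats p q s) =
      A.pats (MarkedPoly.sum (A.evalWord y) p) (MarkedPoly.sum (A.evalWord y) q)
        (MarkedPoly.sum (A.evalWord y) s) := by
  simp only [MarkedPoly.pats, MarkedPoly.sum_append, MarkedPoly.sum_scale,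
    sum_evalWord_halfPats, pats_eq_halfPats_sub, neg_smul, one_smul, sub_eq_add_neg]

/-- Alternating sum of the values of a marked word over the permutations fixing `0`. -/
def altEval {n : ℕ} (v : Fin (n + 1) → D) (m : MarkedWord (Fin (n + 1))) : D :=
  ∑ σ : Equiv.Perm (Fin (n + 1)) with σ 0 = 0, (Equiv.Perm.sign σ : ℤ) • A.evalWord (v ∘ σ) m

lemma altEval_swap {n : ℕ} (v : Fin (n + 1) → D) {i j : Fin (n + 1)} (hi : i ≠ 0) (hj : j ≠ 0)
    (hij : i ≠ j) (m : MarkedWord (Fin (n + 1))) :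
    A.altEval v (m.map (Equiv.swap i j)) = -A.altEval v m := by
  rw [altEval, altEval, ← Finset.sum_neg_distrib]
  refine Finset.sum_equiv (Equiv.mulRight (Equiv.swap i j)) (fun σ => ?_) (fun σ _ => ?_)
  · simp [Equiv.swap_apply_of_ne_of_ne hi.symm hj.symm]
  · simp [evalWord_map, Equiv.Perm.sign_swap hij, Function.comp_assoc]

end Dialgebra

lemma Equiv.Perm.sum_eq_sum_swap_zero {n : ℕ} {M : Type*} [AddCommMonoid M]
    (F : Equiv.Perm (Fin (n + 1)) → M) :
    ∑ σ, F σ = ∑ p, ∑ σ : Equiv.Perm (Fin (n + 1)) with σ 0 = 0, F (σ * Equiv.swap 0 p) := by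
  rw [← Finset.sum_fiberwise (s := Finset.univ) (g := fun σ : Equiv.Perm (Fin (n + 1)) => σ.symm 0)]
  refine Finset.sum_congr rfl fun p _ => ?_
  refine Finset.sum_equiv (Equiv.mulRight (Equiv.swap 0 p)) (fun σ => ?_) (fun σ _ => ?_)
  · simp [Equiv.symm_apply_eq, eq_comm (a := (0 : Fin (n + 1)))]
  · simp [mul_assoc]

lemma Equiv.Perm.alternating_sum_sub_swap {n : ℕ} {M N : Type*} [AddCommGroup M]
    (v : Fin n → N) (G H : (Fin n → N) → M) {i j : Fin n} (hij : i ≠ j)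
    (h : ∀ x, G x = H x - H (x ∘ Equiv.swap i j)) :
    ∑ σ : Equiv.Perm (Fin n), (Equiv.Perm.sign σ : ℤ) • G (v ∘ σ) =
      (2 : ℤ) • ∑ σ : Equiv.Perm (Fin n), (Equiv.Perm.sign σ : ℤ) • H (v ∘ σ) := by
  have hs : ∑ σ : Equiv.Perm (Fin n), (Equiv.Perm.sign σ : ℤ) • H ((v ∘ σ) ∘ Equiv.swap i j) =
      -∑ σ : Equiv.Perm (Fin n), (Equiv.Perm.sign σ : ℤ) • H (v ∘ σ) := by
    rw [← Finset.sum_neg_distrib, ← Equiv.sum_comp (Equiv.mulRight (Equiv.swap i j))]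
    refine Finset.sum_congr rfl fun σ _ => ?_
    simp [Equiv.Perm.sign_swap hij, Function.comp_assoc, ← Equiv.Perm.coe_mul, mul_assoc]
  simp only [h, smul_sub, Finset.sum_sub_distrib, hs]
  abel

namespace MarkedPoly

/-- A fast form of `Equiv.swap`. -/
def swapLetters {n : ℕ} (p q x : Fin n) : Fin n :=
  bif Nat.beq x p then q else bif Nat.beq x q then p else x

lemma swapLetters_eq_swap {n : ℕ} (p q : Fin n) : swapLetters p q = Equiv.swap p q := by
  ext x
  simp only [swapLetters, Equiv.swap_apply_def, Bool.cond_eq_ite, Nat.beq_eq, Fin.val_inj]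

/-- Exchange the `i`-th nonzero letter of a term with the letter `i + 1`, adjusting the sign. -/
def moveLetter {n : ℕ} (t : ℤ × MarkedWord (Fin (n + 1))) (i : ℕ) :
    ℤ × MarkedWord (Fin (n + 1)) :=
  let p : Fin (n + 1) := (t.2.word.filter fun x : Fin (n + 1) => !Nat.beq x 0).getD i 0
  let q := Fin.ofNat (n + 1) (i + 1)
  bif Nat.beq p 0 || Nat.beq q 0 || Nat.beq p q then t else (-t.1, t.2.map (swapLetters p q))

/-- Sort the nonzero letters of a term, adjusting the sign. -/
def sortLetters {n : ℕ} (t : ℤ × MarkedWord (Fin (n + 1))) : ℤ × MarkedWord (Fin (n + 1)) :=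
  (List.range n).foldl moveLetter t

/-- Split a polynomial by the given tests on words, and check that in each resulting class,
after applying `norm` to the terms, all words are equal and the coefficients add up to zero. -/
def cancels {ι : Type*} [DecidableEq ι] (norm : ℤ × MarkedWord ι → ℤ × MarkedWord ι) :
    List (MarkedWord ι → Bool) → MarkedPoly ι → Bool
  | _, [] => true
  | [], t :: p =>
    p.all (fun s => (norm s).2 = (norm t).2) && ((t :: p).map fun s => (norm s).1).sum == 0
  | f :: fs, t :: p =>
    cancels norm fs ((t :: p).filter fun s => f s.2) &&
      cancels norm fs ((t :: p).filter fun s => !f s.2)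

lemma sum_filter_add_sum_filter_not {ι D : Type*} [AddCommGroup D] (φ : MarkedWord ι → D)
    (f : MarkedWord ι → Bool) (p : MarkedPoly ι) :
    sum φ (p.filter fun s => f s.2) + sum φ (p.filter fun s => !f s.2) = sum φ p := by
  induction p with
  | nil => simp
  | cons t p ih =>
    rw [sum_cons, ← ih]
    cases h : f t.2 <;> simp [h] <;> abel

lemma sum_eq_of_forall_eq {ι D : Type*} [AddCommGroup D] (φ : MarkedWord ι → D)
    (norm : ℤ × MarkedWord ι → ℤ × MarkedWord ι)
    (hnorm : ∀ t, (norm t).1 • φ (norm t).2 = t.1 • φ t.2)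
    (m : MarkedWord ι) (p : MarkedPoly ι) (h : ∀ s ∈ p, (norm s).2 = m) :
    sum φ p = (p.map fun s => (norm s).1).sum • φ m := by
  induction p with
  | nil => simp
  | cons t p ih =>
    rw [List.forall_mem_cons] at h
    simp [ih h.2, ← hnorm t, h.1, add_smul]

lemma sum_eq_zero_of_cancels {ι D : Type*} [DecidableEq ι] [AddCommGroup D]
    (φ : MarkedWord ι → D) (norm : ℤ × MarkedWord ι → ℤ × MarkedWord ι)
    (hnorm : ∀ t, (norm t).1 • φ (norm t).2 = t.1 • φ t.2)
    (fs : List (MarkedWord ι → Bool)) (p : MarkedPoly ι) (h : cancels norm fs p) :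
    sum φ p = 0 := by
  induction fs generalizing p with
  | nil =>
    cases p with
    | nil => rfl
    | cons t p =>
      simp only [cancels, Bool.and_eq_true, beq_iff_eq, List.all_eq_true,
        decide_eq_true_eq] at h
      rw [sum_eq_of_forall_eq φ norm hnorm (norm t).2 _ (by simpa using h.1), h.2, zero_smul]
  | cons f fs ih =>
    cases p with
    | nil => rfl
    | cons t p =>
      rw [cancels, Bool.and_eq_true] at h
      rw [← sum_filter_add_sum_filter_not φ f, ih _ h.1, ih _ h.2, add_zero]

end MarkedPoly

namespace Dialgebra

variable {k D : Type*} [CommRing k] [AddCommGroup D] [Module k D] (A : Dialgebra k D)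
  {n : ℕ} (v : Fin (n + 1) → D)

lemma altEval_moveLetter (t : ℤ × MarkedWord (Fin (n + 1))) (i : ℕ) :
    (MarkedPoly.moveLetter t i).1 • A.altEval v (MarkedPoly.moveLetter t i).2 =
      t.1 • A.altEval v t.2 := by
  dsimp only [MarkedPoly.moveLetter]
  generalize List.getD _ _ _ = p
  generalize Fin.ofNat (n + 1) _ = q
  rw [Bool.cond_eq_ite]
  split_ifs with h
  · rfl
  · simp only [Bool.or_eq_true, Nat.beq_eq, Fin.val_eq_zero_iff, Fin.val_inj, not_or] at h
    rw [MarkedPoly.swapLetters_eq_swap, A.altEval_swap v h.1.1 h.1.2 h.2, neg_smul_neg]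

lemma altEval_sortLetters (t : ℤ × MarkedWord (Fin (n + 1))) :
    (MarkedPoly.sortLetters t).1 • A.altEval v (MarkedPoly.sortLetters t).2 =
      t.1 • A.altEval v t.2 := by
  rw [MarkedPoly.sortLetters]
  induction List.range n generalizing t with
  | nil => rfl
  | cons i s ih => rw [List.foldl_cons, ih, altEval_moveLetter]

/-- A formal polynomial whose alternating sum over all permutations of the letters collects
to zero has vanishing alternating sum in every dialgebra. -/
lemma alternating_sum_eq_zero (P : (Fin (n + 1) → Fin (n + 1)) → MarkedPoly (Fin (n + 1)))
    (G : (Fin (n + 1) → D) → D → D)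
    (hG : ∀ (y : Fin (n + 1) → D) q, MarkedPoly.sum (A.evalWord y) (P q) = G (y ∘ q) (y 0))
    (fs : List (MarkedWord (Fin (n + 1)) → Bool))
    (hP : MarkedPoly.cancels MarkedPoly.sortLetters fs ((List.finRange (n + 1)).flatMap fun p =>
      MarkedPoly.scale (if p = 0 then 1 else -1) (P (Equiv.swap 0 p)))) :
    ∑ σ : Equiv.Perm (Fin (n + 1)), (Equiv.Perm.sign σ : ℤ) • G (v ∘ σ) (v 0) = 0 := by
  have h := MarkedPoly.sum_eq_zero_of_cancels _ _ (A.altEval_sortLetters v) fs _ hP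
  have hflat : ∀ (s : List (Fin (n + 1))) (Q : Fin (n + 1) → MarkedPoly (Fin (n + 1))),
      MarkedPoly.sum (A.altEval v) (s.flatMap Q) =
        (s.map fun p => MarkedPoly.sum (A.altEval v) (Q p)).sum := by
    intro s Q
    induction s with
    | nil => rfl
    | cons p s ih => simp [ih]
  rw [hflat, ← List.ofFn_eq_map, List.sum_ofFn] at h
  rw [← h, Equiv.Perm.sum_eq_sum_swap_zero]
  refine Finset.sum_congr rfl fun p _ => ?_
  rw [MarkedPoly.sum_scale]
  change _ = _ • MarkedPoly.sum (fun m => A.altEval v m) _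
  simp only [altEval]
  rw [← MarkedPoly.sum_finset_sum, Finset.smul_sum]
  refine Finset.sum_congr rfl fun σ hσ => ?_
  rw [hG, Function.comp_apply, (Finset.mem_filter.mp hσ).2, smul_smul, Equiv.Perm.sign_mul,
    Equiv.Perm.sign_swap', mul_comm, Function.comp_assoc, ← Equiv.Perm.coe_mul]
  congr 2
  by_cases hp : p = 0 <;> simp [hp, eq_comm]

end Dialgebra

namespace MarkedPoly

/-- A formal polynomial whose alternation is a quarter of `3Σ₁ − Σ₂ − Σ₃ − 2Σ₄`; here `q`
chooses the letters to be permuted and the fixed letter is `0`. -/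
def I31111 (q : Fin 5 → Fin 5) : MarkedPoly (Fin 5) :=
  let a := var 0
  let x := fun i => var (q i)
  scale 3 (halfPats (pats (halfPats a (x 0) (x 1)) a (x 2)) (x 3) (x 4))
    ++ scale (-1) (halfPats (pats a (halfPats (x 0) (x 1) (x 2)) a) (x 3) (x 4))
    ++ scale (-1) (pats (halfPats a (x 0) (x 1)) (halfPats (x 2) (x 3) (x 4)) a)
    ++ scale (-1) (pats a (pats (halfPats (x 1) (x 2) (x 3)) a (x 4)) (x 0))

/-- Tests for the position of the center, in binary, and for the positions of the letter `0`;
they separate the words of length `7` with three letters `0` and sorted nonzero letters. -/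
def wordTests : List (MarkedWord (Fin 5) → Bool) :=
  ((List.range 3).map fun i m => m.left.length.testBit i) ++
    ((List.range 6).map fun i m => Nat.beq ((m.word.drop i).headD 0) 0)

lemma cancels_I31111 :
    cancels sortLetters wordTests ((List.finRange 5).flatMap fun p =>
      scale (if p = 0 then 1 else -1) (I31111 (Equiv.swap 0 p))) := by
  decide +kernel

end MarkedPoly

/-- the PATS satisfies the nonlinear degree-7 identity
`12·I₃₁₁₁₁ = 3Σ₁ − Σ₂ − Σ₃ − 2Σ₄ = 0` in the variables `a,a,a,b,c,d,e`, where `σ`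
permutes the five letters `(a,b,c,d,e)` (with `aσ = ![a,b,c,d,e] (σ 0)`, …) and
Σ₁ = Σ ε(σ)[[[a,aσ,bσ],a,cσ],dσ,eσ], Σ₂ = Σ ε(σ)[[a,[aσ,bσ,cσ],a],dσ,eσ],
Σ₃ = Σ ε(σ)[[a,aσ,bσ],[cσ,dσ,eσ],a], Σ₄ = Σ ε(σ)[a,[[bσ,cσ,dσ],a,eσ],aσ]. -/
theorem pats_identity_I31111
    (k D : Type*) [CommRing k] [AddCommGroup D] [Module k D]
    (A : Dialgebra k D) (a b c d e : D) :
    (3 : ℤ) • (∑ σ : Equiv.Perm (Fin 5), (Equiv.Perm.sign σ : ℤ) •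
        A.pats (A.pats (A.pats a (![a,b,c,d,e] (σ 0)) (![a,b,c,d,e] (σ 1)))
          a (![a,b,c,d,e] (σ 2))) (![a,b,c,d,e] (σ 3)) (![a,b,c,d,e] (σ 4)))
    - (∑ σ : Equiv.Perm (Fin 5), (Equiv.Perm.sign σ : ℤ) •
        A.pats (A.pats a (A.pats (![a,b,c,d,e] (σ 0)) (![a,b,c,d,e] (σ 1))
          (![a,b,c,d,e] (σ 2))) a) (![a,b,c,d,e] (σ 3)) (![a,b,c,d,e] (σ 4)))
    - (∑ σ : Equiv.Perm (Fin 5), (Equiv.Perm.sign σ : ℤ) •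
        A.pats (A.pats a (![a,b,c,d,e] (σ 0)) (![a,b,c,d,e] (σ 1)))
          (A.pats (![a,b,c,d,e] (σ 2)) (![a,b,c,d,e] (σ 3)) (![a,b,c,d,e] (σ 4))) a)
    - (2 : ℤ) • (∑ σ : Equiv.Perm (Fin 5), (Equiv.Perm.sign σ : ℤ) •
        A.pats a (A.pats (A.pats (![a,b,c,d,e] (σ 1)) (![a,b,c,d,e] (σ 2))
          (![a,b,c,d,e] (σ 3))) a (![a,b,c,d,e] (σ 4))) (![a,b,c,d,e] (σ 0)))
    = 0 := by
  set v : Fin 5 → D := ![a, b, c, d, e]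
  have h := A.alternating_sum_eq_zero v MarkedPoly.I31111
    (fun x a => (3 : ℤ) • A.halfPats (A.pats (A.halfPats a (x 0) (x 1)) a (x 2)) (x 3) (x 4)
      - A.halfPats (A.pats a (A.halfPats (x 0) (x 1) (x 2)) a) (x 3) (x 4)
      - A.pats (A.halfPats a (x 0) (x 1)) (A.halfPats (x 2) (x 3) (x 4)) a
      - A.pats a (A.pats (A.halfPats (x 1) (x 2) (x 3)) a (x 4)) (x 0))
    (fun y q => by
      simp only [MarkedPoly.I31111, MarkedPoly.sum_append, MarkedPoly.sum_scale,
        Dialgebra.sum_evalWord_pats, Dialgebra.sum_evalWord_halfPats,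
        Dialgebra.sum_evalWord_var, Function.comp_apply, neg_smul, one_smul, sub_eq_add_neg])
    MarkedPoly.wordTests MarkedPoly.cancels_I31111
  have h₁ := (Equiv.Perm.alternating_sum_sub_swap v
    (fun x => A.pats (A.pats (A.pats a (x 0) (x 1)) a (x 2)) (x 3) (x 4))
    (fun x => A.halfPats (A.pats (A.pats a (x 0) (x 1)) a (x 2)) (x 3) (x 4))
    (i := 3) (j := 4) (by decide) fun x => A.pats_eq_halfPats_sub _ _ _).trans
    (congrArg ((2 : ℤ) • ·) (Equiv.Perm.alternating_sum_sub_swap v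
      (fun x => A.halfPats (A.pats (A.pats a (x 0) (x 1)) a (x 2)) (x 3) (x 4))
      (fun x => A.halfPats (A.pats (A.halfPats a (x 0) (x 1)) a (x 2)) (x 3) (x 4))
      (i := 0) (j := 1) (by decide) fun x => by
        rw [A.pats_eq_halfPats_sub a (x 0), A.pats_sub_left, A.halfPats_sub_left]
        rfl))
  have h₂ := (Equiv.Perm.alternating_sum_sub_swap v
    (fun x => A.pats (A.pats a (A.pats (x 0) (x 1) (x 2)) a) (x 3) (x 4))
    (fun x => A.halfPats (A.pats a (A.pats (x 0) (x 1) (x 2)) a) (x 3) (x 4))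
    (i := 3) (j := 4) (by decide) fun x => A.pats_eq_halfPats_sub _ _ _).trans
    (congrArg ((2 : ℤ) • ·) (Equiv.Perm.alternating_sum_sub_swap v
      (fun x => A.halfPats (A.pats a (A.pats (x 0) (x 1) (x 2)) a) (x 3) (x 4))
      (fun x => A.halfPats (A.pats a (A.halfPats (x 0) (x 1) (x 2)) a) (x 3) (x 4))
      (i := 1) (j := 2) (by decide) fun x => by
        rw [A.pats_eq_halfPats_sub (x 0), A.pats_sub_middle, A.halfPats_sub_left]
        rfl))
  have h₃ := (Equiv.Perm.alternating_sum_sub_swap v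
    (fun x => A.pats (A.pats a (x 0) (x 1)) (A.pats (x 2) (x 3) (x 4)) a)
    (fun x => A.pats (A.halfPats a (x 0) (x 1)) (A.pats (x 2) (x 3) (x 4)) a)
    (i := 0) (j := 1) (by decide) fun x => by
      rw [A.pats_eq_halfPats_sub a (x 0), A.pats_sub_left]
      rfl).trans
    (congrArg ((2 : ℤ) • ·) (Equiv.Perm.alternating_sum_sub_swap v
      (fun x => A.pats (A.halfPats a (x 0) (x 1)) (A.pats (x 2) (x 3) (x 4)) a)
      (fun x => A.pats (A.halfPats a (x 0) (x 1)) (A.halfPats (x 2) (x 3) (x 4)) a)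
      (i := 3) (j := 4) (by decide) fun x => by
        rw [A.pats_eq_halfPats_sub (x 2), A.pats_sub_middle]
        rfl))
  have h₄ := Equiv.Perm.alternating_sum_sub_swap v
    (fun x => A.pats a (A.pats (A.pats (x 1) (x 2) (x 3)) a (x 4)) (x 0))
    (fun x => A.pats a (A.pats (A.halfPats (x 1) (x 2) (x 3)) a (x 4)) (x 0))
    (i := 2) (j := 3) (by decide) fun x => by
      rw [A.pats_eq_halfPats_sub (x 1), A.pats_sub_left, A.pats_sub_middle]
      rfl
  have hv : v 0 = a := rfl
  simp only [hv, smul_sub, Finset.sum_sub_distrib, smul_comm _ (3 : ℤ), ← Finset.smul_sum] at h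
  simp only [Function.comp_apply] at h h₁ h₂ h₃ h₄
  rw [h₁, h₂, h₃, h₄]
  refine Eq.trans ?_ ((congrArg ((4 : ℤ) • ·) h).trans (smul_zero _))
  module
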